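/- For α ∈ ℂ with α ≠ 0, let N_14^α be the 4-dimensional ℂ-algebra with basis e_1,e_2,e_3,e_4 and only nonzero basis products e_1e_2 = e_4, e_2e_1 = α e_4, e_2e_2 = e_3. Each of the six bilinear forms Δ₁₁, Δ₂₁, Δ₂₃, Δ₁₃+Δ₂₄, Δ₃₂, αΔ₃₁+Δ₄₂ is a cocycle on N_14^α, and their cosets modulo B²(N_14^α,ℂ) form a basis of H²(N_14^α,ℂ); in particular dim H²(N_14^α,ℂ) = 6 for every α ≠ 0. -/

import Mathlib

/-- The elementary bilinear multiplication on `ℂ^n` sending `(x, y)` to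
`(x_i * y_j) • e_k`; the concrete algebra below is a sum of such terms. -/
noncomputable def T {n : ℕ} (i j k : Fin n) :
    (Fin n → ℂ) →ₗ[ℂ] (Fin n → ℂ) →ₗ[ℂ] (Fin n → ℂ) :=
  LinearMap.mk₂ ℂ (fun x y => (x i * y j) • (Pi.single k 1 : Fin n → ℂ))
    (fun x x' y => by simp [add_mul, add_smul])
    (fun c x y => by simp [smul_eq_mul, smul_smul, mul_assoc])
    (fun x y y' => by simp [mul_add, add_smul])
    (fun c x y => by simp [smul_eq_mul, smul_smul, mul_left_comm])

/-- The bilinear form `Δ_{ij}` on `ℂ^n` (0-indexed): `Δ_{ij}(x,y) = x_i y_j`,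
so that `Δ_{ij}(e_l, e_m) = δ_{il} δ_{jm}`. -/
noncomputable def D {n : ℕ} (i j : Fin n) :
    (Fin n → ℂ) →ₗ[ℂ] (Fin n → ℂ) →ₗ[ℂ] ℂ :=
  LinearMap.mk₂ ℂ (fun x y => x i * y j)
    (fun x x' y => by simp [add_mul])
    (fun c x y => by simp [mul_assoc])
    (fun x y y' => by simp [mul_add])
    (fun c x y => by simp [smul_eq_mul, mul_left_comm])

/-- The cocycle condition: `θ(xy,z) = θ(xz,y)` and `θ(x,yz) = θ(y,xz)`. -/
def IsCocycle {A V : Type*} [AddCommGroup A] [Module ℂ A] [AddCommGroup V] [Module ℂ V]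
    (m : A →ₗ[ℂ] A →ₗ[ℂ] A) (θ : A →ₗ[ℂ] A →ₗ[ℂ] V) : Prop :=
  (∀ x y z : A, θ (m x y) z = θ (m x z) y) ∧ (∀ x y z : A, θ x (m y z) = θ y (m x z))

/-- `Z²(A,ℂ)`: the space of scalar-valued cocycles. -/
noncomputable def Zsub {A : Type*} [AddCommGroup A] [Module ℂ A]
    (m : A →ₗ[ℂ] A →ₗ[ℂ] A) : Submodule ℂ (A →ₗ[ℂ] A →ₗ[ℂ] ℂ) where
  carrier := {θ | IsCocycle m θ}
  add_mem' := by
    rintro θ η ⟨h1, h2⟩ ⟨g1, g2⟩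
    refine ⟨fun x y z => ?_, fun x y z => ?_⟩
    · simp only [LinearMap.add_apply]
      rw [h1 x y z, g1 x y z]
    · simp only [LinearMap.add_apply]
      rw [h2 x y z, g2 x y z]
  zero_mem' := ⟨fun x y z => by simp, fun x y z => by simp⟩
  smul_mem' := by
    rintro c θ ⟨h1, h2⟩
    refine ⟨fun x y z => ?_, fun x y z => ?_⟩
    · simp only [LinearMap.smul_apply]
      rw [h1 x y z]
    · simp only [LinearMap.smul_apply]
      rw [h2 x y z]

/-- The coboundary map `f ↦ δf = ((x,y) ↦ f(xy))`. -/
noncomputable def cobound {A : Type*} [AddCommGroup A] [Module ℂ A]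
    (m : A →ₗ[ℂ] A →ₗ[ℂ] A) : (A →ₗ[ℂ] ℂ) →ₗ[ℂ] (A →ₗ[ℂ] A →ₗ[ℂ] ℂ) where
  toFun f := m.compr₂ f
  map_add' f g := by ext x y; simp [LinearMap.compr₂_apply]
  map_smul' c f := by ext x y; simp [LinearMap.compr₂_apply]

/-- `B²(A,ℂ)`: the space of scalar-valued coboundaries. -/
noncomputable def Bsub {A : Type*} [AddCommGroup A] [Module ℂ A]
    (m : A →ₗ[ℂ] A →ₗ[ℂ] A) : Submodule ℂ (A →ₗ[ℂ] A →ₗ[ℂ] ℂ) :=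
  LinearMap.range (cobound m)

/-- The coset of a bilinear form modulo `B²(A,ℂ)`. -/
noncomputable def cls {A : Type*} [AddCommGroup A] [Module ℂ A]
    (m : A →ₗ[ℂ] A →ₗ[ℂ] A) (θ : A →ₗ[ℂ] A →ₗ[ℂ] ℂ) :
    (A →ₗ[ℂ] A →ₗ[ℂ] ℂ) ⧸ Bsub m :=
  (Bsub m).mkQ θ

/-- `H²(A,ℂ) = Z²(A,ℂ)/B²(A,ℂ)`, realized as the image of the cocycles in the
quotient of the space of all bilinear forms by the coboundaries. -/
noncomputable def H2 {A : Type*} [AddCommGroup A] [Module ℂ A]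
    (m : A →ₗ[ℂ] A →ₗ[ℂ] A) : Submodule ℂ ((A →ₗ[ℂ] A →ₗ[ℂ] ℂ) ⧸ Bsub m) :=
  (Zsub m).map (Bsub m).mkQ

/-- The algebra `N_14^α` on `ℂ^4`: `e_1 e_2 = e_4`, `e_2 e_1 = α e_4`, `e_2 e_2 = e_3`. -/
noncomputable def mul (α : ℂ) : (Fin 4 → ℂ) →ₗ[ℂ] (Fin 4 → ℂ) →ₗ[ℂ] (Fin 4 → ℂ) :=
  T 0 1 3 + α • T 1 0 3 + T 1 1 2

/-- The forms `Δ₁₁, Δ₂₁, Δ₂₃, Δ₁₃+Δ₂₄, Δ₃₂, αΔ₃₁+Δ₄₂` (0-indexed). -/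
noncomputable def forms (α : ℂ) : Fin 6 → ((Fin 4 → ℂ) →ₗ[ℂ] (Fin 4 → ℂ) →ₗ[ℂ] ℂ) :=
  ![D 0 0, D 1 0, D 1 2, D 0 2 + D 1 3, D 2 1, α • D 2 0 + D 3 1]

theorem mul_apply_eq (α : ℂ) (x y : Fin 4 → ℂ) :
    mul α x y = ![0, 0, x 1 * y 1, x 0 * y 1 + α * (x 1 * y 0)] := by
  ext k
  fin_cases k <;> simp [mul, T]

theorem D_apply {n : ℕ} (i j : Fin n) (x y : Fin n → ℂ) : D i j x y = x i * y j := rfl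

theorem forms_isCocycle (α : ℂ) (i : Fin 6) : IsCocycle (mul α) (forms α i) := by
  constructor <;> intro x y z <;> fin_cases i <;>
    simp [forms, D_apply, mul_apply_eq] <;> ring

theorem mem_Bsub_iff (α : ℂ) (θ : (Fin 4 → ℂ) →ₗ[ℂ] (Fin 4 → ℂ) →ₗ[ℂ] ℂ) :
    θ ∈ Bsub (mul α) ↔ ∃ f : (Fin 4 → ℂ) →ₗ[ℂ] ℂ, ∀ x y, f (mul α x y) = θ x y := by
  simp only [Bsub, LinearMap.mem_range, LinearMap.ext_iff]
  rfl

theorem sum_forms_apply (α : ℂ) (c : Fin 6 → ℂ) (x y : Fin 4 → ℂ) :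
    (∑ i, c i • forms α i) x y =
      c 0 * (x 0 * y 0) + c 1 * (x 1 * y 0) + c 2 * (x 1 * y 2) +
        c 3 * (x 0 * y 2 + x 1 * y 3) + c 4 * (x 2 * y 1) +
        c 5 * (α * (x 2 * y 0) + x 3 * y 1) := by
  simp [Fin.sum_univ_succ, forms, D_apply]
  ring

theorem sum_cls (α : ℂ) (c : Fin 6 → ℂ) :
    ∑ i, c i • cls (mul α) (forms α i) = (Bsub (mul α)).mkQ (∑ i, c i • forms α i) := by
  simp [cls]

theorem linearIndependent_cls_forms (α : ℂ) :
    LinearIndependent ℂ (fun i => cls (mul α) (forms α i)) := by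
  rw [Fintype.linearIndependent_iff]
  intro c hc
  rw [sum_cls, Submodule.mkQ_apply, Submodule.Quotient.mk_eq_zero, mem_Bsub_iff] at hc
  obtain ⟨f, hf⟩ := hc
  simp only [sum_forms_apply, mul_apply_eq] at hf
  have hz : f ![0, 0, 0, 0] = 0 := by
    convert f.map_zero
    ext k; fin_cases k <;> rfl
  have h0 := hf ![1, 0, 0, 0] ![1, 0, 0, 0]
  have h01 := hf ![1, 0, 0, 0] ![0, 1, 0, 0]
  have h1 := hf ![0, 1, 0, 0] ![1, 0, 0, 0]
  have h2 := hf ![0, 1, 0, 0] ![0, 0, 1, 0]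
  have h3 := hf ![0, 1, 0, 0] ![0, 0, 0, 1]
  have h4 := hf ![0, 0, 1, 0] ![0, 1, 0, 0]
  have h5 := hf ![0, 0, 0, 1] ![0, 1, 0, 0]
  have hα : f ![0, 0, 0, α] = α * f ![0, 0, 0, 1] := by
    rw [← smul_eq_mul, ← map_smul]; simp
  simp [hz, hα] at h0 h01 h1 h2 h3 h4 h5
  intro i
  fin_cases i <;> grind

theorem exists_sub_sum_forms_mem_Bsub {α : ℂ} (hα : α ≠ 0)
    {θ : (Fin 4 → ℂ) →ₗ[ℂ] (Fin 4 → ℂ) →ₗ[ℂ] ℂ} (hθ : IsCocycle (mul α) θ) :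
    ∃ c : Fin 6 → ℂ, θ - ∑ i, c i • forms α i ∈ Bsub (mul α) := by
  obtain ⟨hl, hr⟩ := hθ
  let e : Fin 4 → Fin 4 → ℂ := fun i => Pi.single i 1
  let t : Fin 4 → Fin 4 → ℂ := fun i j => θ (e i) (e j)
  have m01 : mul α (e 0) (e 1) = e 3 := by
    rw [mul_apply_eq]; ext k; fin_cases k <;> simp [e]
  have m10 : mul α (e 1) (e 0) = α • e 3 := by
    rw [mul_apply_eq]; ext k; fin_cases k <;> simp [e]
  have m11 : mul α (e 1) (e 1) = e 2 := by
    rw [mul_apply_eq]; ext k; fin_cases k <;> simp [e]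
  have m0 : ∀ j, j ≠ 1 → mul α (e 0) (e j) = 0 := by
    intro j hj; rw [mul_apply_eq]; ext k; fin_cases j <;> fin_cases k <;> simp_all [e]
  have m1 : ∀ j, j ≠ 0 → j ≠ 1 → mul α (e 1) (e j) = 0 := by
    intro j hj hj'; rw [mul_apply_eq]; ext k; fin_cases j <;> fin_cases k <;> simp_all [e]
  have n0 : ∀ j, j ≠ 1 → mul α (e j) (e 0) = 0 := by
    intro j hj; rw [mul_apply_eq]; ext k; fin_cases j <;> fin_cases k <;> simp_all [e]
  have row3 : ∀ j, j ≠ 1 → t 3 j = 0 := fun j hj => by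
    simpa [m01, m0 j hj] using hl (e 0) (e 1) (e j)
  have col3 : ∀ j, j ≠ 1 → t j 3 = 0 := fun j hj => by
    simpa [m10, n0 j hj, hα] using hr (e j) (e 1) (e 0)
  have row2 : ∀ j, j ≠ 0 → j ≠ 1 → t 2 j = 0 := fun j hj hj' => by
    simpa [m11, m1 j hj hj'] using hl (e 1) (e 1) (e j)
  have t20 : t 2 0 = α * t 3 1 := by
    simpa [m10, m11] using hl (e 1) (e 1) (e 0)
  have t02 : t 0 2 = t 1 3 := by
    simpa [m01, m11] using hr (e 0) (e 1) (e 1)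
  refine ⟨![t 0 0, t 1 0 - α * t 0 1, t 1 2, t 1 3, t 2 1, t 3 1], ?_⟩
  rw [mem_Bsub_iff]
  refine ⟨t 0 1 • LinearMap.proj 3 + t 1 1 • LinearMap.proj 2, fun x y => ?_⟩
  have hθ : θ x y = ∑ i, ∑ j, x i * (y j * t i j) := by
    conv_lhs => rw [pi_eq_sum_univ' x, pi_eq_sum_univ' y]
    simp only [map_sum, map_smul, LinearMap.sum_apply, LinearMap.smul_apply, smul_eq_mul,
      Finset.mul_sum, t, e]
    rw [Finset.sum_comm]
    exact Finset.sum_congr rfl fun i _ => Finset.sum_congr rfl fun j _ => mul_left_comm _ _ _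
  rw [LinearMap.sub_apply, LinearMap.sub_apply, sum_forms_apply, hθ, mul_apply_eq]
  simp [Fin.sum_univ_four, row3, row2, col3, t20, t02]
  ring

theorem span_cls_forms {α : ℂ} (hα : α ≠ 0) :
    Submodule.span ℂ (Set.range fun i => cls (mul α) (forms α i)) = H2 (mul α) := by
  apply le_antisymm
  · rw [Submodule.span_le]
    rintro _ ⟨i, rfl⟩
    exact ⟨forms α i, forms_isCocycle α i, rfl⟩
  · rintro _ ⟨θ, hθ, rfl⟩
    obtain ⟨c, hc⟩ := exists_sub_sum_forms_mem_Bsub hα hθ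
    rw [Submodule.mem_span_range_iff_exists_fun]
    exact ⟨c, (sum_cls α c).trans ((Submodule.Quotient.eq _).2 hc).symm⟩

/-- The listed forms are cocycles, their cosets modulo `B²` form a basis of `H²`,
and in particular `dim H² = 6`. -/
theorem secondCohomology_N14 (α : ℂ) (hα : α ≠ 0) :
    (∀ i, IsCocycle (mul α) (forms α i)) ∧
    LinearIndependent ℂ (fun i => cls (mul α) (forms α i)) ∧
    Submodule.span ℂ (Set.range fun i => cls (mul α) (forms α i)) = H2 (mul α) ∧
    Module.finrank ℂ (H2 (mul α)) = 6 := by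
  refine ⟨forms_isCocycle α, linearIndependent_cls_forms α, span_cls_forms hα, ?_⟩
  rw [← span_cls_forms hα, finrank_span_eq_card (linearIndependent_cls_forms α), Fintype.card_fin]
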